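/- If S is a GAS numerical semigroup that is not symmetric, then ⟨K⟩ \ K = {F(S) − x₁, …, F(S) − x_r, F(S)} for some r ≥ 0 and minimal generators x₁, …, x_r of S with x_i − x_j ∉ PF(S) for every i, j. (That is, every element of the semigroup generated by K that is not in K has the form F(S) − x with x = 0 or x a minimal generator.) -/

import Mathlib

open Set Pointwise

def IsNumSgrp (S : Set ℤ) : Prop :=
  0 ∈ S ∧ (∀ a ∈ S, ∀ b ∈ S, a + b ∈ S) ∧ (∀ a ∈ S, 0 ≤ a) ∧ ∃ c : ℤ, ∀ z, c ≤ z → z ∈ S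

def maxId (S : Set ℤ) : Set ℤ := S \ {0}

def subI (I J : Set ℤ) : Set ℤ := {x : ℤ | ∀ j ∈ J, x + j ∈ I}

def PF (S I : Set ℤ) : Set ℤ := subI I (maxId S) \ I

def stdK (S : Set ℤ) (F : ℤ) : Set ℤ := {x : ℤ | 0 ≤ x ∧ F - x ∉ S}

def IsFrobOf (I : Set ℤ) (FI : ℤ) : Prop := FI ∉ I ∧ ∀ z : ℤ, FI < z → z ∈ I

def IsRelIdeal (S I : Set ℤ) : Prop :=
  I.Nonempty ∧ (∀ i ∈ I, ∀ s ∈ S, i + s ∈ I) ∧ ∃ z ∈ S, ∀ i ∈ I, z + i ∈ S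

def tilde (I : Set ℤ) (d : ℤ) : Set ℤ := (fun x => x + d) '' I

def IsAlmostCanonical (S : Set ℤ) (F : ℤ) (I : Set ℤ) : Prop :=
  ∃ FI : ℤ, IsFrobOf I FI ∧ subI (tilde I (F - FI)) (maxId S) = stdK S F ∪ {F}

def IsMinGen (S : Set ℤ) (x : ℤ) : Prop := x ∈ maxId S \ (maxId S + maxId S)

def IsMult (S : Set ℤ) (e : ℤ) : Prop := e ∈ maxId S ∧ ∀ m ∈ maxId S, e ≤ m

def genK (S : Set ℤ) (F : ℤ) : Set ℤ := (AddSubmonoid.closure (stdK S F) : Set ℤ)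

def nK (K : Set ℤ) : ℕ → Set ℤ
  | 0 => {0}
  | 1 => K
  | n + 2 => nK K (n + 1) + K

def IsGAS (S : Set ℤ) (F : ℤ) : Prop :=
  stdK S F + stdK S F = stdK S F ∨
  ∃ X : Finset ℤ, (∀ x ∈ X, IsMinGen S x) ∧ (∀ x ∈ X, ∀ y ∈ X, x - y ∉ PF S S) ∧
    (stdK S F + stdK S F) \ stdK S F = (fun x => F - x) '' (X : Set ℤ) ∪ {F}

def IsAlmostSym (S : Set ℤ) (F : ℤ) : Prop := subI S (maxId S) = stdK S F ∪ {F}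

def apery (I : Set ℤ) (e : ℤ) : Set ℤ := {i ∈ I | i - e ∉ I}

theorem subset_stdK {S : Set ℤ} (hS : IsNumSgrp S) {F : ℤ} (hF : F ∉ S) : S ⊆ stdK S F :=
  fun s hs => ⟨hS.2.2.1 s hs, fun h => hF (by simpa using hS.2.1 _ h _ hs)⟩

/-- If the canonical ideal is closed under addition, the semigroup is symmetric. -/
theorem eq_stdK_of_add_eq {S : Set ℤ} (hS : IsNumSgrp S) {F : ℤ} (hF : IsFrobOf S F)
    (h : stdK S F + stdK S F = stdK S F) : S = stdK S F := by
  refine Set.Subset.antisymm (subset_stdK hS hF.1) fun k hk => ?_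
  by_contra hkS
  have hle : k ≤ F := by
    by_contra! hlt
    exact hkS (hF.2 k hlt)
  have hmem : F - k ∈ stdK S F := ⟨by omega, by simpa using hkS⟩
  have hFK : F ∈ stdK S F := by
    rw [← h]
    exact ⟨F - k, hmem, k, hk, by ring⟩
  exact hFK.2 (by simpa using hS.1)

theorem sub_mem_stdK_of_notMem {S : Set ℤ} {F : ℤ} (hF : IsFrobOf S F) {z : ℤ} (hz : z ∉ S) :
    F - z ∈ stdK S F := by
  refine ⟨?_, by simpa using hz⟩
  by_contra! hlt
  exact hz (hF.2 z (by omega))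

/-- Every element of the semigroup generated by the canonical ideal is nonnegative; if it is
`F - x` with `x` in the maximal ideal, then `x` is indecomposable and no `x - y` with `y` in the
maximal ideal is a pseudo-Frobenius number. -/
theorem genK_indecomposable {S : Set ℤ} (hS : IsNumSgrp S) {F : ℤ} (hF : IsFrobOf S F)
    {X : Finset ℤ} (hmin : ∀ x ∈ X, IsMinGen S x) (hPF : ∀ x ∈ X, ∀ y ∈ X, x - y ∉ PF S S)
    (hX : (stdK S F + stdK S F) \ stdK S F = (fun x => F - x) '' (X : Set ℤ) ∪ {F})
    {u : ℤ} (hu : u ∈ genK S F) :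
    0 ≤ u ∧ (∀ a ∈ maxId S, ∀ b ∈ maxId S, F - (a + b) ≠ u) ∧
      ∀ x ∈ maxId S, ∀ y ∈ maxId S, x - y ∈ PF S S → F - x ≠ u := by
  have hpos : ∀ m ∈ maxId S, 0 < m := fun m hm =>
    lt_of_le_of_ne (hS.2.2.1 m hm.1) (Ne.symm hm.2)
  have hadd : ∀ a ∈ maxId S, ∀ b ∈ maxId S, a + b ∈ maxId S := fun a ha b hb =>
    ⟨hS.2.1 a ha.1 b hb.1, by have := hpos a ha; have := hpos b hb; simp; omega⟩
  have hmemX : ∀ m ∈ maxId S, ∀ k ∈ stdK S F, ∀ l ∈ stdK S F, F - m = k + l → m ∈ X := by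
    intro m hm k hk l hl he
    have hd : F - m ∈ (stdK S F + stdK S F) \ stdK S F :=
      ⟨⟨k, hk, l, hl, he.symm⟩, fun h => h.2 (by simpa using hm.1)⟩
    rw [hX] at hd
    have := hpos m hm
    rcases hd with ⟨x, hx, hxe⟩ | hd
    · have : x = m := by simp only at hxe; omega
      exact this ▸ hx
    · simp only [mem_singleton_iff] at hd
      omega
  have hsumX : ∀ a ∈ maxId S, ∀ b ∈ maxId S, a + b ∉ X := fun a ha b hb h =>
    (hmin _ h).2 ⟨a, ha, b, hb, rfl⟩
  have hcompl : ∀ v, 0 ≤ v → v ∉ stdK S F → F - v ∈ S := fun v hv h => by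
    by_contra hn
    exact h ⟨hv, hn⟩
  unfold genK at hu
  induction hu using AddSubmonoid.closure_induction_right with
  | zero =>
    have h0 : (0 : ℤ) ∈ stdK S F := subset_stdK hS hF.1 hS.1
    refine ⟨le_rfl, fun a ha b hb he => h0.2 ?_, fun x hx y _ _ he => h0.2 ?_⟩
    · rw [← he]; simpa using (hadd a ha b hb).1
    · rw [← he]; simpa using hx.1
  | add_right u _ k hk ih =>
    obtain ⟨hu0, ihsum, ihPF⟩ := ih
    have hk0 : 0 ≤ k := hk.1
    refine ⟨by omega, fun a ha b hb he => ?_, fun x hx y hy hf he => ?_⟩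
    · have ha0 := hpos a ha
      have hb0 := hpos b hb
      by_cases huK : u ∈ stdK S F
      · exact hsumX a ha b hb (hmemX _ (hadd a ha b hb) u huK k hk he)
      have habk : a + b + k ∈ S := by
        have := hcompl u hu0 huK
        rwa [show F - u = a + b + k by omega] at this
      have hkb : k + b ∉ S := fun h =>
        ihsum a ha (k + b) ⟨h, by simp; omega⟩ (by omega)
      have hkbPF : k + b ∈ PF S S := by
        refine ⟨fun m hm => ?_, hkb⟩
        by_contra hn
        exact hsumX b hb m hm (hmemX _ (hadd b hb m hm) k hk _ (sub_mem_stdK_of_notMem hF hn)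
          (by ring))
      exact ihPF (a + b + k) ⟨habk, by simp; omega⟩ a ha
        (by rwa [show a + b + k - a = k + b by ring]) (by omega)
    · have hx0 := hpos x hx
      have hy0 := hpos y hy
      obtain ⟨f, rfl⟩ : ∃ f, x = y + f := ⟨x - y, by ring⟩
      rw [add_sub_cancel_left] at hf
      have hfFS : F - f ∉ S := fun h => hF.1 (by
        have := hf.1 (F - f) ⟨h, by simp; omega⟩
        simpa using this)
      have hf0 : 0 < f := by
        rcases lt_trichotomy f 0 with h | h | h
        · exact absurd (hF.2 (F - f) (by omega)) hfFS
        · exact absurd (h ▸ hS.1) hf.2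
        · exact h
      have hfK : f ∈ stdK S F := ⟨hf0.le, hfFS⟩
      by_cases huK : u ∈ stdK S F
      · have hxX := hmemX _ hx u huK k hk he
        by_cases hufK : u + f ∈ stdK S F
        · exact hPF _ hxX y (hmemX y hy (u + f) hufK k hk (by omega))
            (by rwa [add_sub_cancel_left])
        · have hyk := hcompl (u + f) (by omega) hufK
          have := hf.1 (F - (u + f)) ⟨hyk, by simp; omega⟩
          exact huK.2 (by rwa [show f + (F - (u + f)) = F - u by ring] at this)
      · have hxk : y + f + k ∈ S := by
          have := hcompl u hu0 huK
          rwa [show F - u = y + f + k by omega] at this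
        have hfk : f + k ∉ S := fun h =>
          ihsum y hy (f + k) ⟨h, by simp; omega⟩ (by omega)
        have hfkPF : f + k ∈ PF S S := by
          refine ⟨fun m hm => ?_, hfk⟩
          by_contra hn
          have hm0 := hpos m hm
          have hkm : k + m ∉ S := fun h => hn (by
            have := hf.1 (k + m) ⟨h, by simp; omega⟩
            rwa [← add_assoc] at this)
          have hmX := hmemX m hm k hk _ (sub_mem_stdK_of_notMem hF hkm) (by ring)
          have hfmX := hmemX (f + m) ⟨hf.1 m hm, by simp; omega⟩ k hk _
            (sub_mem_stdK_of_notMem hF hn) (by ring)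
          exact hPF _ hfmX _ hmX (by rwa [add_sub_cancel_right])
        exact ihPF (y + f + k) ⟨hxk, by simp; omega⟩ y hy
          (by rwa [show y + f + k - y = f + k by ring]) (by omega)

theorem stmt13 (S : Set ℤ) (hS : IsNumSgrp S) (F : ℤ) (hF : IsFrobOf S F)
    (hgas : IsGAS S F) (hnotsym : S ≠ stdK S F) :
    ∃ X : Finset ℤ, (∀ x ∈ X, IsMinGen S x) ∧ (∀ x ∈ X, ∀ y ∈ X, x - y ∉ PF S S) ∧
      genK S F \ stdK S F = (fun x => F - x) '' (X : Set ℤ) ∪ {F} := by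
  rcases hgas with h | ⟨X, hmin, hPF, hX⟩
  · exact absurd (eq_stdK_of_add_eq hS hF h) hnotsym
  have key := fun u hu => genK_indecomposable hS hF hmin hPF hX (u := u) hu
  have hfin : {x | IsMinGen S x ∧ F - x ∈ genK S F}.Finite :=
    (Set.finite_Icc 0 F).subset fun x hx =>
      ⟨hS.2.2.1 x hx.1.1.1, by have := (key _ hx.2).1; omega⟩
  refine ⟨hfin.toFinset, fun x hx => (hfin.mem_toFinset.1 hx).1, fun x hx y hy hf => ?_, ?_⟩
  · rw [hfin.mem_toFinset] at hx hy
    exact (key _ hx.2).2.2 x hx.1.1 y hy.1.1 hf rfl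
  rw [hfin.coe_toFinset]
  apply Set.Subset.antisymm
  · rintro z ⟨hz, hzK⟩
    have hzS : F - z ∈ S := by
      by_contra h
      exact hzK ⟨(key z hz).1, h⟩
    by_cases h0 : F - z = 0
    · right
      simp only [mem_singleton_iff]
      omega
    · refine Or.inl ⟨F - z, ⟨⟨⟨hzS, h0⟩, ?_⟩, by simpa using hz⟩, by simp⟩
      rintro ⟨a, ha, b, hb, hab⟩
      exact (key z hz).2.1 a ha b hb (by simp only at hab; omega)
  · rintro z (⟨x, ⟨hx, hz⟩, rfl⟩ | rfl)
    · exact ⟨hz, fun h => h.2 (by simpa using hx.1.1)⟩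
    · have hmem : z ∈ (stdK S z + stdK S z) \ stdK S z := hX ▸ Or.inr rfl
      obtain ⟨⟨k, hk, l, hl, he⟩, hn⟩ := hmem
      refine ⟨?_, hn⟩
      have := add_mem (AddSubmonoid.subset_closure hk) (AddSubmonoid.subset_closure hl)
      simp only at he
      rw [he] at this
      exact this
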